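/- arXiv:2005.13345 — 11 statements merged into one kernel-verified Lean document; each statement's English description precedes it below -/
import Mathlib

section
/- Let X be a nonempty set, K > 0, and D : X × X → [0,∞) a b-metric on X with coefficient K. Then the b-metric space X is metrizable: there exists a metric ρ : X × X → [0,∞) on X whose metric topology coincides with the D-topology on X. -/
open Filter Topology Uniformity in
/-- The uniform structure whose entourages are generated by the sets `{p | D p.1 p.2 < r}`, `r > 0`,
for a b-metric `D` is induced by a pseudometric, which is therefore uniformly equivalent to `D`. -/
theorem exists_pseudoMetricSpace_uniformly_equivalent {X : Type*} (K : ℝ) (hK : 0 < K)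
    (D : X → X → ℝ)
    (hD_nonneg : ∀ x y, 0 ≤ D x y)
    (hD_self : ∀ x, D x x = 0)
    (hD_symm : ∀ x y, D x y = D y x)
    (hD_tri : ∀ x y z, D x z ≤ K * (D x y + D y z)) :
    ∃ I : PseudoMetricSpace X,
      (∀ r > 0, ∃ s > 0, ∀ x y, D x y < s → I.dist x y < r) ∧
      (∀ r > 0, ∃ s > 0, ∀ x y, I.dist x y < s → D x y < r) := by
  have basis : (comap (fun p : X × X => D p.1 p.2) (𝓝 0)).HasBasis (fun r : ℝ => 0 < r)
      (fun r => {p : X × X | D p.1 p.2 < r}) := by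
    refine ((nhds_basis_abs_sub_lt (0 : ℝ)).comap _).congr (fun _ => Iff.rfl) fun r _ => ?_
    ext p
    simp [abs_of_nonneg (hD_nonneg p.1 p.2)]
  let C : UniformSpace.Core X :=
    { uniformity := comap (fun p : X × X => D p.1 p.2) (𝓝 0)
      refl := basis.ge_iff.2 fun r hr => by
        rintro ⟨x, y⟩ h
        obtain rfl : x = y := by simpa using h
        simpa [hD_self] using hr
      symm := by
        refine basis.tendsto_iff basis |>.2 fun r hr => ⟨r, hr, fun p hp => ?_⟩
        change D p.2 p.1 < r
        rw [hD_symm]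
        exact hp
      comp := by
        refine basis.ge_iff.2 fun r hr => ?_
        have hs : 0 < r / (2 * K) := by positivity
        refine mem_of_superset (mem_lift' (basis.mem_of_mem hs)) ?_
        rintro ⟨x, z⟩ ⟨y, hxy, hyz⟩
        change D x y < r / (2 * K) at hxy
        change D y z < r / (2 * K) at hyz
        change D x z < r
        calc D x z ≤ K * (D x y + D y z) := hD_tri x y z
          _ < K * (r / (2 * K) + r / (2 * K)) := by gcongr
          _ = r := by field_simp; ring }
  let U : UniformSpace X := UniformSpace.ofCore C
  have hU : 𝓤 X = comap (fun p : X × X => D p.1 p.2) (𝓝 0) := rfl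
  have : IsCountablyGenerated (𝓤 X) := hU ▸ inferInstance
  obtain ⟨I, hI⟩ := UniformSpace.metrizable_uniformity X
  have basis_dist := @Metric.uniformity_basis_dist X I
  rw [hI, hU] at basis_dist
  refine ⟨I, fun r hr => ?_, fun r hr => ?_⟩
  · obtain ⟨s, hs, h⟩ := basis.mem_iff.1 (basis_dist.mem_of_mem hr)
    exact ⟨s, hs, fun x y hxy => @h (x, y) hxy⟩
  · obtain ⟨s, hs, h⟩ := basis_dist.mem_iff.1 (basis.mem_of_mem hr)
    exact ⟨s, hs, fun x y hxy => @h (x, y) hxy⟩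

/-- Every b-metric space (coefficient `K > 0`) is metrizable: there is a
metric `ρ` on `X` whose metric topology coincides with the `D`-topology, i.e. a set `U`
is open for `D` (every point of `U` has a `D`-ball inside `U`) iff it is open for `ρ`. -/
theorem bMetric_metrizable {X : Type*} [Nonempty X] (K : ℝ) (hK : 0 < K)
    (D : X → X → ℝ)
    (hD_nonneg : ∀ x y, 0 ≤ D x y)
    (hD_eq : ∀ x y, D x y = 0 ↔ x = y)
    (hD_symm : ∀ x y, D x y = D y x)
    (hD_tri : ∀ x y z, D x z ≤ K * (D x y + D y z)) :
    ∃ ρ : X → X → ℝ,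
      (∀ x y, 0 ≤ ρ x y) ∧
      (∀ x y, ρ x y = 0 ↔ x = y) ∧
      (∀ x y, ρ x y = ρ y x) ∧
      (∀ x y z, ρ x z ≤ ρ x y + ρ y z) ∧
      (∀ U : Set X,
        (∀ x ∈ U, ∃ r > 0, ∀ y, D x y < r → y ∈ U) ↔
        (∀ x ∈ U, ∃ r > 0, ∀ y, ρ x y < r → y ∈ U)) := by
  obtain ⟨I, hID, hDI⟩ := exists_pseudoMetricSpace_uniformly_equivalent K hK D hD_nonneg
    (fun x => (hD_eq x x).2 rfl) hD_symm hD_tri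
  refine ⟨I.dist, fun x y => dist_nonneg, fun x y => ⟨fun h => ?_, ?_⟩, dist_comm, dist_triangle,
    fun U => ⟨fun h x hx => ?_, fun h x hx => ?_⟩⟩
  · refine (hD_eq x y).1 (le_antisymm (le_of_forall_pos_le_add fun r hr => ?_) (hD_nonneg x y))
    obtain ⟨s, hs, hsr⟩ := hDI r hr
    simpa using (hsr x y (h ▸ hs)).le
  · rintro rfl
    exact dist_self x
  · obtain ⟨r, hr, hrU⟩ := h x hx
    obtain ⟨s, hs, hsr⟩ := hDI r hr
    exact ⟨s, hs, fun y hy => hrU y (hsr x y hy)⟩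
  · obtain ⟨r, hr, hrU⟩ := h x hx
    obtain ⟨s, hs, hsr⟩ := hID r hr
    exact ⟨s, hs, fun y hy => hrU y (hsr x y hy)⟩
end

section
/- Let (X, D) be an F-metric space with respect to a pair (f, α). Then X is metrizable: there exists a metric ρ : X × X → [0,∞) on X whose metric topology coincides with the D-topology on X. -/
open Filter Topology Finset

/-- `f : (0,∞) → ℝ` (modelled on all of `ℝ`, only its values on positive reals matter)
belongs to the class `𝓕`: it is nondecreasing on `(0,∞)` and, for every sequence of
positive reals `t`, `t n → 0` iff `f (t n) → -∞`. -/
def IsFClassFun (f : ℝ → ℝ) : Prop :=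
  (∀ s t : ℝ, 0 < s → s < t → f s ≤ f t) ∧
  (∀ t : ℕ → ℝ, (∀ n, 0 < t n) →
    (Tendsto t atTop (𝓝 0) ↔ Tendsto (fun n => f (t n)) atTop atBot))

/-- `D` is an `𝓕`-metric on `X` with respect to `(f, α)`. -/
def IsFMetric {X : Type*} (D : X → X → ℝ) (f : ℝ → ℝ) (α : ℝ) : Prop :=
  (∀ x y, 0 ≤ D x y) ∧
  (∀ x y, D x y = 0 ↔ x = y) ∧
  (∀ x y, D x y = D y x) ∧
  (∀ x y : X, 0 < D x y → ∀ N : ℕ, 2 ≤ N → ∀ u : ℕ → X, u 0 = x → u (N - 1) = y →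
    f (D x y) ≤ f (∑ i ∈ Finset.range (N - 1), D (u i) (u (i + 1))) + α)

open scoped Uniformity

/-- A function of class `𝓕` can only satisfy `f t ≤ f s + α` with `s` small if `t` is small. -/
theorem IsFClassFun.exists_pos_forall_lt {f : ℝ → ℝ} (hf : IsFClassFun f) (α : ℝ) {ε : ℝ}
    (hε : 0 < ε) : ∃ δ > 0, ∀ s t, 0 < s → s < δ → f t ≤ f s + α → t < ε := by
  by_contra! h
  choose s t hs hsn hst ht using fun n : ℕ => h (1 / ((n : ℝ) + 1)) Nat.one_div_pos_of_nat
  have h_lim : Tendsto s atTop (𝓝 0) :=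
    squeeze_zero (fun n => (hs n).le) (fun n => (hsn n).le) tendsto_one_div_add_atTop_nhds_zero_nat
  obtain ⟨n, hn⟩ := (((hf.2 s hs).1 h_lim).eventually_lt_atBot (f ε - α)).exists
  have h_mono : f ε ≤ f (t n) := by
    rcases (ht n).eq_or_lt with h_eq | h_lt
    · rw [h_eq]
    · exact hf.1 _ _ hε h_lt
  linarith [hst n]

/-- A symmetric distance function satisfying a uniform weak form of the triangle inequality is
uniformly equivalent to a metric. -/
theorem exists_metricSpace_of_relaxed_triangle {X : Type*} {D : X → X → ℝ}
    (h_nonneg : ∀ x y, 0 ≤ D x y) (h_zero : ∀ x y, D x y = 0 ↔ x = y)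
    (h_symm : ∀ x y, D x y = D y x)
    (h_half : ∀ ε > 0, ∃ δ > 0, ∀ x y z, D x y < δ → D y z < δ → D x z < ε) :
    ∃ _ : MetricSpace X,
      (∀ ε > 0, ∃ δ > 0, ∀ x y : X, D x y < δ → dist x y < ε) ∧
      (∀ ε > 0, ∃ δ > 0, ∀ x y : X, dist x y < δ → D x y < ε) := by
  let F : Filter (X × X) := comap (fun p => D p.1 p.2) (𝓝 0)
  have hF : F.HasBasis (fun ε : ℝ => 0 < ε) fun ε => {p | D p.1 p.2 < ε} := by
    have h := (Metric.nhds_basis_ball (x := (0 : ℝ))).comap fun p : X × X => D p.1 p.2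
    refine h.congr (fun _ => Iff.rfl) fun ε _ => ?_
    ext p
    simp [abs_of_nonneg (h_nonneg p.1 p.2)]
  let u : UniformSpace X := .ofCore
    { uniformity := F
      refl := hF.ge_iff.2 fun ε hε => by
        rintro ⟨x, y⟩ (rfl : x = y)
        simpa [(h_zero x x).2 rfl] using hε
      symm := (hF.tendsto_iff hF).2 fun ε hε => ⟨ε, hε, fun p hp => by
        simpa [h_symm p.2 p.1] using hp⟩
      comp := hF.ge_iff.2 fun ε hε => by
        obtain ⟨δ, hδ, h⟩ := h_half ε hε
        refine mem_of_superset (mem_lift' (hF.mem_of_mem hδ)) ?_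
        rintro ⟨x, z⟩ ⟨y, hxy, hyz⟩
        exact h x y z hxy hyz }
  have hu : (𝓤 X).HasBasis (fun ε : ℝ => 0 < ε) fun ε => {p | D p.1 p.2 < ε} := hF
  have : IsCountablyGenerated (𝓤 X) :=
    inferInstanceAs (IsCountablyGenerated (comap (fun p : X × X => D p.1 p.2) (𝓝 0)))
  have : T0Space X := t0Space_iff_uniformity.2 fun x y h => by
    by_contra hxy
    have h_pos : 0 < D x y := (h_nonneg x y).lt_of_ne' fun h0 => hxy ((h_zero x y).1 h0)
    exact lt_irrefl (D x y) (h {p | D p.1 p.2 < D x y} (hu.mem_of_mem h_pos))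
  let m : MetricSpace X := UniformSpace.metricSpace X
  have hm : (𝓤 X).HasBasis (fun ε : ℝ => 0 < ε) fun ε => {p : X × X | dist p.1 p.2 < ε} :=
    Metric.uniformity_basis_dist
  refine ⟨m, fun ε hε => ?_, fun ε hε => ?_⟩
  · obtain ⟨δ, hδ, h⟩ := hu.mem_iff.1 (hm.mem_of_mem hε)
    exact ⟨δ, hδ, fun x y hxy => @h (x, y) hxy⟩
  · obtain ⟨δ, hδ, h⟩ := hm.mem_iff.1 (hu.mem_of_mem hε)
    exact ⟨δ, hδ, fun x y hxy => @h (x, y) hxy⟩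

/-- Every `𝓕`-metric space is metrizable: there is a metric `ρ` on `X`
whose metric topology coincides with the `D`-topology, i.e. a set `U` is open for `D`
(every point of `U` has a `D`-ball inside `U`) iff it is open for `ρ`. -/
theorem fMetric_metrizable {X : Type*} [Nonempty X] (D : X → X → ℝ) (f : ℝ → ℝ) (α : ℝ)
    (hf : IsFClassFun f) (hα : 0 ≤ α) (hD : IsFMetric D f α) :
    ∃ ρ : X → X → ℝ,
      (∀ x y, 0 ≤ ρ x y) ∧
      (∀ x y, ρ x y = 0 ↔ x = y) ∧
      (∀ x y, ρ x y = ρ y x) ∧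
      (∀ x y z, ρ x z ≤ ρ x y + ρ y z) ∧
      (∀ U : Set X,
        (∀ x ∈ U, ∃ r > 0, ∀ y, D x y < r → y ∈ U) ↔
        (∀ x ∈ U, ∃ r > 0, ∀ y, ρ x y < r → y ∈ U)) := by
  obtain ⟨h_nonneg, h_zero, h_symm, h_chain⟩ := hD
  have h_half : ∀ ε > 0, ∃ δ > 0, ∀ x y z, D x y < δ → D y z < δ → D x z < ε := by
    intro ε hε
    obtain ⟨δ, hδ, h⟩ := hf.exists_pos_forall_lt α hε
    refine ⟨δ / 2, half_pos hδ, fun x y z hxy hyz => ?_⟩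
    rcases (h_nonneg x z).eq_or_lt with hxz | hxz
    · rwa [← hxz]
    · have h_sum : 0 < D x y + D y z := by
        refine (add_nonneg (h_nonneg x y) (h_nonneg y z)).lt_of_ne fun h0 => hxz.ne' ?_
        have hx : x = y := (h_zero x y).1 (by linarith [h_nonneg x y, h_nonneg y z])
        have hy : y = z := (h_zero y z).1 (by linarith [h_nonneg x y, h_nonneg y z])
        exact (h_zero x z).2 (hx.trans hy)
      refine h _ _ h_sum (by linarith) ?_
      have := h_chain x z hxz 3 (by norm_num)
        (fun n => if n = 0 then x else if n = 1 then y else z) (by simp) (by simp)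
      simpa [Finset.sum_range_succ] using this
  obtain ⟨m, h_le, h_ge⟩ := exists_metricSpace_of_relaxed_triangle h_nonneg h_zero h_symm h_half
  refine ⟨fun x y => dist x y, fun _ _ => dist_nonneg, fun _ _ => dist_eq_zero, dist_comm,
    dist_triangle, fun U => forall₂_congr fun x _ => ⟨?_, ?_⟩⟩
  · rintro ⟨r, hr, hU⟩
    obtain ⟨δ, hδ, h⟩ := h_ge r hr
    exact ⟨δ, hδ, fun y hy => hU y (h x y hy)⟩
  · rintro ⟨r, hr, hU⟩
    obtain ⟨δ, hδ, h⟩ := h_le r hr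
    exact ⟨δ, hδ, fun y hy => hU y (h x y hy)⟩
end

section
/- Let (X, D) be an F-metric space with respect to a pair (f, α). Then D is uniformly regular in the sense of Chittenden: for every ε > 0 there exists φ > 0 such that for all x, y, z ∈ X, if D(x,y) < φ and D(y,z) < φ then D(x,z) < ε. -/
open Filter Topology Finset

/-- A function of class `𝓕` takes values below every bound at some positive real. -/
theorem IsFClassFun.exists_pos_lt {f : ℝ → ℝ} (hf : IsFClassFun f) (c : ℝ) :
    ∃ δ > 0, f δ < c := by
  have h := (hf.2 (fun n : ℕ => 1 / ((n : ℝ) + 1)) fun n => Nat.one_div_pos_of_nat).1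
    tendsto_one_div_add_atTop_nhds_zero_nat
  obtain ⟨n, hn⟩ := (h.eventually (eventually_lt_atBot c)).exists
  exact ⟨_, Nat.one_div_pos_of_nat, hn⟩

/-- The chain inequality of an `𝓕`-metric for chains of three points. -/
theorem IsFMetric.le_add_of_pos {X : Type*} {D : X → X → ℝ} {f : ℝ → ℝ} {α : ℝ}
    (hD : IsFMetric D f α) {x z : X} (hxz : 0 < D x z) (y : X) :
    f (D x z) ≤ f (D x y + D y z) + α := by
  have h := hD.2.2.2 x z hxz 3 (by norm_num)
    (fun i => if i = 0 then x else if i = 1 then y else z) (by simp) (by simp)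
  simpa [Finset.sum_range_succ] using h

/-- The legs of a three-point chain joining distinct points have positive total length. -/
theorem IsFMetric.add_pos {X : Type*} {D : X → X → ℝ} {f : ℝ → ℝ} {α : ℝ}
    (hD : IsFMetric D f α) {x z : X} (hxz : x ≠ z) (y : X) :
    0 < D x y + D y z := by
  obtain ⟨hnn, heq, -, -⟩ := hD
  by_contra! h
  have hxy := hnn x y
  have hyz := hnn y z
  exact hxz (((heq x y).1 (by linarith)).trans ((heq y z).1 (by linarith)))

/-- Any `𝓕`-metric `D` is uniformly regular in the sense of Chittenden. -/
theorem fMetric_uniformlyRegular {X : Type*} [Nonempty X] (D : X → X → ℝ) (f : ℝ → ℝ)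
    (α : ℝ) (hf : IsFClassFun f) (hα : 0 ≤ α) (hD : IsFMetric D f α) :
    ∀ ε : ℝ, 0 < ε →
      ∃ φ > 0, ∀ x y z : X, D x y < φ → D y z < φ → D x z < ε := by
  intro ε hε
  obtain ⟨δ, hδ, hfδ⟩ := hf.exists_pos_lt (f ε - α)
  refine ⟨δ / 2, half_pos hδ, fun x y z hxy hyz => ?_⟩
  by_contra! hxz
  have hpos : 0 < D x z := hε.trans_le hxz
  have hne : x ≠ z := fun h => hpos.ne' ((hD.2.1 x z).2 h)
  have hchain := hD.le_add_of_pos hpos y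
  have hsum := hf.1 _ δ (hD.add_pos hne y) (by linarith)
  have hmono : f ε ≤ f (D x z) := by
    rcases hxz.eq_or_lt with h | h
    · rw [h]
    · exact hf.1 _ _ hε h
  linarith
end

section
/- Let (X, D) be an F-metric space with respect to a pair (f, α). Then D satisfies the Niemytski–Wilson condition (iii-B): for every point a ∈ X and all sequences (a_n) and (b_n) in X, if D(a_n, a) → 0 and D(a_n, b_n) → 0 as n → ∞, then D(b_n, a) → 0 as n → ∞. -/
open Filter Topology Finset

/-- The three-point case of the chain inequality, with the sum replaced by a larger number. -/
theorem IsFMetric.le_of_add_lt {X : Type*} {D : X → X → ℝ} {f : ℝ → ℝ} {α : ℝ}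
    (hf : IsFClassFun f) (hD : IsFMetric D f α) {x y z : X} {r : ℝ} (hxz : 0 < D x z)
    (hr : D x y + D y z < r) : f (D x z) ≤ f r + α := by
  obtain ⟨h_nonneg, h_zero, -, h_chain⟩ := hD
  have hpos : 0 < D x y + D y z := by
    by_contra! hle
    have hxy := (h_zero x y).1 (by linarith [h_nonneg x y, h_nonneg y z])
    have hyz := (h_zero y z).1 (by linarith [h_nonneg x y, h_nonneg y z])
    exact hxz.ne' ((h_zero x z).2 (hxy.trans hyz))
  have h := h_chain x z hxz 3 (by norm_num)
    (fun i => if i = 0 then x else if i = 1 then y else z) (by simp) (by simp)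
  simp only [Nat.add_one_sub_one, Finset.sum_range_succ,
    Finset.sum_range_zero] at h
  norm_num at h
  linarith [hf.1 _ _ hpos hr]

/-- Any `𝓕`-metric `D` satisfies the Niemytski–Wilson condition (iii-B). -/
theorem fMetric_niemytskiWilson_iiiB {X : Type*} [Nonempty X] (D : X → X → ℝ)
    (f : ℝ → ℝ) (α : ℝ) (hf : IsFClassFun f) (hα : 0 ≤ α) (hD : IsFMetric D f α) :
    ∀ (a : X) (a_seq b_seq : ℕ → X),
      Tendsto (fun n => D (a_seq n) a) atTop (𝓝 0) →
      Tendsto (fun n => D (a_seq n) (b_seq n)) atTop (𝓝 0) →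
      Tendsto (fun n => D (b_seq n) a) atTop (𝓝 0) := by
  intro a a_seq b_seq ha hb
  obtain ⟨h_nonneg, -, h_symm, -⟩ := id hD
  set r : ℕ → ℝ := fun n => D (b_seq n) (a_seq n) + D (a_seq n) a + 1 / ((n : ℝ) + 1) with hr
  have hlt : ∀ n, D (b_seq n) (a_seq n) + D (a_seq n) a < r n := fun n =>
    lt_add_of_pos_right _ Nat.one_div_pos_of_nat
  have hr_pos : ∀ n, 0 < r n := fun n =>
    (add_nonneg (h_nonneg _ _) (h_nonneg _ _)).trans_lt (hlt n)
  have hr_lim : Tendsto r atTop (𝓝 0) := by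
    simpa [hr, h_symm] using (hb.add ha).add (tendsto_one_div_add_atTop_nhds_zero_nat (𝕜 := ℝ))
  have hfr := (hf.2 r hr_pos).1 hr_lim
  set t : ℕ → ℝ := fun n => if 0 < D (b_seq n) a then D (b_seq n) a else r n with ht
  have ht_pos : ∀ n, 0 < t n := by
    intro n
    simp only [ht]
    split_ifs with h
    exacts [h, hr_pos n]
  have hft : ∀ n, f (t n) ≤ f (r n) + α := by
    intro n
    simp only [ht]
    split_ifs with h
    · exact hD.le_of_add_lt hf h (hlt n)
    · linarith
  have ht_lim : Tendsto t atTop (𝓝 0) :=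
    (hf.2 t ht_pos).2 (tendsto_atBot_mono hft (tendsto_atBot_add_const_right _ α hfr))
  refine squeeze_zero (fun n => h_nonneg _ _) (fun n => ?_) ht_lim
  simp only [ht]
  split_ifs with h
  exacts [le_rfl, (not_lt.1 h).trans (hr_pos n).le]
end

section
/- Let (X, D) be an F-metric space with respect to a pair (f, α). Then D satisfies the Niemytski–Wilson condition (iii-C): for every a ∈ X and every k > 0 there exists r > 0 such that for all b, c ∈ X, if D(a,b) ≥ k then D(a,c) + D(b,c) ≥ r. -/
open Filter Topology Finset

/-- Any `𝓕`-metric `D` satisfies the Niemytski–Wilson condition (iii-C). -/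
theorem fMetric_niemytskiWilson_iiiC {X : Type*} [Nonempty X] (D : X → X → ℝ)
    (f : ℝ → ℝ) (α : ℝ) (hf : IsFClassFun f) (hα : 0 ≤ α) (hD : IsFMetric D f α) :
    ∀ a : X, ∀ k : ℝ, 0 < k →
      ∃ r > 0, ∀ b c : X, k ≤ D a b → r ≤ D a c + D b c := by
  obtain ⟨hmono, hlim⟩ := hf
  obtain ⟨hnonneg, heq, hsymm, hchain⟩ := hD
  intro a k hk
  have hbot := (hlim (fun n : ℕ => 1 / ((n : ℝ) + 1)) fun n => by positivity).1
    tendsto_one_div_add_atTop_nhds_zero_nat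
  obtain ⟨n, hn⟩ := (hbot.eventually (eventually_lt_atBot (f k - α))).exists
  refine ⟨1 / ((n : ℝ) + 1), by positivity, fun b c hb => ?_⟩
  by_contra! hlt
  have hab : 0 < D a b := hk.trans_le hb
  have hpos : 0 < D a c + D b c := by
    refine (add_nonneg (hnonneg a c) (hnonneg b c)).lt_of_ne fun h => hab.ne' ?_
    have hac := (heq a c).1 (by linarith [hnonneg a c, hnonneg b c])
    have hbc := (heq b c).1 (by linarith [hnonneg a c, hnonneg b c])
    exact (heq a b).2 (hac.trans hbc.symm)
  have hpath := hchain a b hab 3 (by norm_num)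
    (fun i => if i = 0 then a else if i = 1 then c else b) (by simp) (by simp)
  simp only [Nat.reduceSub, Finset.sum_range_succ, Finset.sum_range_zero] at hpath
  norm_num [hsymm c b] at hpath
  have hkb : f k ≤ f (D a b) := by
    rcases hb.eq_or_lt with h | h
    · rw [← h]
    · exact hmono _ _ hk h
  have hr := hmono _ _ hpos hlt
  linarith
end

section
/- Let (X, d, θ) be a θ-metric space, where θ is a B-action. Then X is metrizable: there exists a metric ρ : X × X → [0,∞) on X whose metric topology coincides with the d-topology on X. -/
open Filter Topology

/-- `θ : [0,∞) × [0,∞) → [0,∞)` (modelled on all of `ℝ × ℝ`, only the values at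
nonnegative arguments matter) is a `B`-action: it maps nonnegative pairs to
nonnegative values, is continuous in each variable separately (on `[0,∞)`), and
satisfies conditions (i)–(iv). -/
structure IsBAction (θ : ℝ → ℝ → ℝ) : Prop where
  nonneg : ∀ s t : ℝ, 0 ≤ s → 0 ≤ t → 0 ≤ θ s t
  contOn_right : ∀ s : ℝ, 0 ≤ s → ContinuousOn (fun t => θ s t) (Set.Ici 0)
  contOn_left : ∀ t : ℝ, 0 ≤ t → ContinuousOn (fun s => θ s t) (Set.Ici 0)
  map_zero_zero : θ 0 0 = 0
  symm : ∀ s t : ℝ, 0 ≤ s → 0 ≤ t → θ s t = θ t s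
  strict_mono : ∀ x y s t : ℝ, 0 ≤ x → 0 ≤ y → 0 ≤ s → 0 ≤ t →
    ((x ≤ s ∧ y < t) ∨ (x < s ∧ y ≤ t)) → θ x y < θ s t
  surj_on : ∀ m : ℝ, (∃ s t : ℝ, 0 ≤ s ∧ 0 ≤ t ∧ θ s t = m) →
    ∀ t : ℝ, 0 ≤ t → t ≤ m → ∃ s : ℝ, 0 ≤ s ∧ s ≤ m ∧ θ s t = m
  le_self : ∀ s : ℝ, 0 < s → θ s 0 ≤ s

/-- `d` is a `θ`-metric on `X` with respect to the `B`-action `θ`. -/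
structure IsThetaMetric {X : Type*} (d : X → X → ℝ) (θ : ℝ → ℝ → ℝ) : Prop where
  nonneg : ∀ x y, 0 ≤ d x y
  eq_iff : ∀ x y, d x y = 0 ↔ x = y
  symm : ∀ x y, d x y = d y x
  tri : ∀ x y z, d x z ≤ θ (d x y) (d y z)

namespace IsBAction

theorem mono {θ : ℝ → ℝ → ℝ} (hθ : IsBAction θ) {x y s t : ℝ} (hx : 0 ≤ x) (hy : 0 ≤ y)
    (hxs : x ≤ s) (hyt : y ≤ t) : θ x y ≤ θ s t := by
  rcases hyt.lt_or_eq with h | rfl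
  · exact (hθ.strict_mono x y s t hx hy (hx.trans hxs) (hy.trans hyt) (.inl ⟨hxs, h⟩)).le
  · rcases hxs.lt_or_eq with h | rfl
    · exact (hθ.strict_mono x y s y hx hy (hx.trans hxs) hy (.inr ⟨h, le_rfl⟩)).le
    · exact le_rfl

theorem exists_pos_lt {θ : ℝ → ℝ → ℝ} (hθ : IsBAction θ) {ε : ℝ} (hε : 0 < ε) :
    ∃ δ > 0, θ δ δ < ε := by
  have hs : 0 < ε / 2 := half_pos hε
  have hlt : θ (ε / 2) 0 < ε := (hθ.le_self _ hs).trans_lt (half_lt_self hε)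
  have hev : ∀ᶠ t in 𝓝[>] (0 : ℝ), θ (ε / 2) t < ε :=
    ((hθ.contOn_right _ hs.le 0 Set.self_mem_Ici).eventually_lt_const hlt).filter_mono
      (nhdsWithin_mono _ Set.Ioi_subset_Ici_self)
  obtain ⟨t, ht, ht0⟩ := (hev.and self_mem_nhdsWithin).exists
  have hδ : 0 < min (ε / 2) t := lt_min hs ht0
  exact ⟨_, hδ, (hθ.mono hδ.le hδ.le (min_le_left _ _) (min_le_right _ _)).trans_lt ht⟩

end IsBAction

namespace IsThetaMetric

theorem hasBasis_comap {X : Type*} {d : X → X → ℝ} {θ : ℝ → ℝ → ℝ} (hd : IsThetaMetric d θ) :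
    (comap (fun p : X × X => d p.1 p.2) (𝓝 0)).HasBasis (fun ε : ℝ => 0 < ε)
      fun ε => {p | d p.1 p.2 < ε} := by
  have h := (Metric.nhds_basis_ball (x := (0 : ℝ))).comap (fun p : X × X => d p.1 p.2)
  refine h.congr (fun _ => Iff.rfl) fun ε _ => ?_
  ext p
  simp [abs_of_nonneg (hd.nonneg _ _)]

/-- The uniform structure of a `θ`-metric, generated by the entourages `{(x, y) | d x y < ε}`. -/
abbrev uniformSpace {X : Type*} {d : X → X → ℝ} {θ : ℝ → ℝ → ℝ} (hd : IsThetaMetric d θ)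
    (hθ : IsBAction θ) : UniformSpace X :=
  .ofCore
    { uniformity := comap (fun p : X × X => d p.1 p.2) (𝓝 0)
      refl := by
        refine hd.hasBasis_comap.ge_iff.2 fun ε hε => ?_
        rintro ⟨x, y⟩ (rfl : x = y)
        simpa [(hd.eq_iff x x).2 rfl] using hε
      symm := by
        refine (hd.hasBasis_comap.tendsto_iff hd.hasBasis_comap).2 fun ε hε => ⟨ε, hε, ?_⟩
        rintro ⟨x, y⟩ hxy
        exact (hd.symm y x).trans_lt hxy
      comp := by
        refine hd.hasBasis_comap.ge_iff.2 fun ε hε => ?_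
        obtain ⟨δ, hδ, hlt⟩ := hθ.exists_pos_lt hε
        refine mem_of_superset (mem_lift' (hd.hasBasis_comap.mem_of_mem hδ)) ?_
        rintro ⟨x, z⟩ ⟨y, hxy, hyz⟩
        exact ((hd.tri x y z).trans (hθ.mono (hd.nonneg _ _) (hd.nonneg _ _)
          (le_of_lt hxy) (le_of_lt hyz))).trans_lt hlt }

end IsThetaMetric

/-- Every `θ`-metric space (with `θ` a `B`-action) is metrizable: there is
a metric `ρ` on `X` whose metric topology coincides with the `d`-topology, i.e. a set
`U` is open for `d` (every point of `U` has a `d`-ball inside `U`) iff it is open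
for `ρ`. -/
theorem thetaMetric_metrizable {X : Type*} [Nonempty X] (θ : ℝ → ℝ → ℝ)
    (hθ : IsBAction θ) (d : X → X → ℝ) (hd : IsThetaMetric d θ) :
    ∃ ρ : X → X → ℝ,
      (∀ x y, 0 ≤ ρ x y) ∧
      (∀ x y, ρ x y = 0 ↔ x = y) ∧
      (∀ x y, ρ x y = ρ y x) ∧
      (∀ x y z, ρ x z ≤ ρ x y + ρ y z) ∧
      (∀ U : Set X,
        (∀ x ∈ U, ∃ r > 0, ∀ y, d x y < r → y ∈ U) ↔
        (∀ x ∈ U, ∃ r > 0, ∀ y, ρ x y < r → y ∈ U)) := by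
  let u := hd.uniformSpace hθ
  have : IsCountablyGenerated (uniformity X) :=
    inferInstanceAs (IsCountablyGenerated (comap (fun p : X × X => d p.1 p.2) (𝓝 0)))
  obtain ⟨I, hI⟩ := UniformSpace.metrizable_uniformity X
  have hunif : @uniformity X I.toUniformSpace = comap (fun p : X × X => d p.1 p.2) (𝓝 0) := by
    rw [hI]
    rfl
  have hbasis : (comap (fun p : X × X => d p.1 p.2) (𝓝 0)).HasBasis (fun ε : ℝ => 0 < ε)
      fun ε => {p | I.dist p.1 p.2 < ε} := hunif ▸ Metric.uniformity_basis_dist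
  have hdρ : ∀ ε > 0, ∃ δ > 0, ∀ x y, d x y < δ → I.dist x y < ε := fun ε hε =>
    let ⟨δ, hδ, h⟩ := hd.hasBasis_comap.mem_iff.1 (hbasis.mem_of_mem hε)
    ⟨δ, hδ, fun x y hxy => @h (x, y) hxy⟩
  have hρd : ∀ ε > 0, ∃ δ > 0, ∀ x y, I.dist x y < δ → d x y < ε := fun ε hε =>
    let ⟨δ, hδ, h⟩ := hbasis.mem_iff.1 (hd.hasBasis_comap.mem_of_mem hε)
    ⟨δ, hδ, fun x y hxy => @h (x, y) hxy⟩
  refine ⟨I.dist, fun x y => @dist_nonneg X I x y, fun x y => ⟨fun h => ?_, ?_⟩, I.dist_comm,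
    I.dist_triangle, fun U => ⟨fun hU x hx => ?_, fun hU x hx => ?_⟩⟩
  · refine (hd.eq_iff x y).1 (le_antisymm (le_of_forall_pos_lt_add fun ε hε => ?_) (hd.nonneg x y))
    obtain ⟨δ, hδ, H⟩ := hρd ε hε
    simpa using H x y (h.trans_lt hδ)
  · rintro rfl
    exact I.dist_self x
  · obtain ⟨r, hr, H⟩ := hU x hx
    obtain ⟨δ, hδ, H'⟩ := hρd r hr
    exact ⟨δ, hδ, fun y hy => H y (H' x y hy)⟩
  · obtain ⟨r, hr, H⟩ := hU x hx
    obtain ⟨δ, hδ, H'⟩ := hdρ r hr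
    exact ⟨δ, hδ, fun y hy => H y (H' x y hy)⟩
end

section
/- Let θ be a B-action. Then θ is continuous at the point (0,0): for all sequences (s_n) and (t_n) in [0,∞), if (s_n, t_n) → (0,0) as n → ∞ (in the Euclidean norm on ℝ², equivalently s_n → 0 and t_n → 0), then θ(s_n, t_n) → θ(0,0) = 0 as n → ∞. -/
open Filter Topology

/-- A `B`-action `θ` is continuous at `(0,0)`: for any sequences
`(s_n)`, `(t_n)` of nonnegative reals with `s_n → 0` and `t_n → 0`, we have
`θ (s_n) (t_n) → θ 0 0 = 0`. -/
theorem bAction_continuousAt_zero (θ : ℝ → ℝ → ℝ) (hθ : IsBAction θ) :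
    ∀ s t : ℕ → ℝ, (∀ n, 0 ≤ s n) → (∀ n, 0 ≤ t n) →
      Tendsto s atTop (𝓝 0) → Tendsto t atTop (𝓝 0) →
      Tendsto (fun n => θ (s n) (t n)) atTop (𝓝 0) := by
  intro s t hs ht hs0 ht0
  have ht0' : Tendsto t atTop (𝓝[Set.Ici 0] 0) :=
    tendsto_nhdsWithin_iff.2 ⟨ht0, .of_forall ht⟩
  refine tendsto_order.2 ⟨fun b hb => .of_forall fun n =>
    hb.trans_le (hθ.nonneg _ _ (hs n) (ht n)), fun ε hε => ?_⟩
  have ha : 0 < ε / 2 := half_pos hε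
  have hlt : θ (ε / 2) 0 < ε := (hθ.le_self _ ha).trans_lt (half_lt_self hε)
  have hev := ((hθ.contOn_right _ ha.le 0 Set.self_mem_Ici).tendsto.comp ht0').eventually_lt_const hlt
  filter_upwards [hev, hs0.eventually_lt_const ha] with n hn hsn
  exact (hθ.strict_mono _ _ _ _ (hs n) (ht n) ha.le (ht n) (.inr ⟨hsn, le_rfl⟩)).trans hn
end

section
/- Let (X, d, θ) be a θ-metric space, where θ is a B-action. Then d satisfies the Niemytski–Wilson condition (iii-B): for every point a ∈ X and all sequences (a_n) and (b_n) in X, if d(a_n, a) → 0 and d(a_n, b_n) → 0 as n → ∞, then d(b_n, a) → 0 as n → ∞. -/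
open Filter Topology

/-- A `B`-action is jointly small near the origin. -/
theorem IsBAction.exists_forall_lt {θ : ℝ → ℝ → ℝ} (hθ : IsBAction θ) {ε : ℝ} (hε : 0 < ε) :
    ∃ δ > 0, ∀ s t : ℝ, 0 ≤ s → 0 ≤ t → s < δ → t < δ → θ s t < ε := by
  have h_lt : θ (ε / 2) 0 < ε := (hθ.le_self _ (half_pos hε)).trans_lt (half_lt_self hε)
  have h_near : ∀ᶠ t in 𝓝[≥] (0 : ℝ), θ (ε / 2) t < ε :=
    (hθ.contOn_right _ (half_pos hε).le 0 Set.self_mem_Ici).eventually_lt_const h_lt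
  obtain ⟨u, hu, hsub⟩ := mem_nhdsGE_iff_exists_Ico_subset.mp h_near
  refine ⟨min (ε / 2) u, lt_min (half_pos hε) hu, fun s t hs ht hsδ htδ => ?_⟩
  have hsε : s < ε / 2 := hsδ.trans_le (min_le_left _ _)
  exact (hθ.strict_mono s t (ε / 2) t hs ht (half_pos hε).le ht (Or.inr ⟨hsε, le_rfl⟩)).trans
    (hsub ⟨ht, htδ.trans_le (min_le_right _ _)⟩)

/-- Any `θ`-metric `d` satisfies the Niemytski–Wilson condition (iii-B). -/
theorem thetaMetric_niemytskiWilson_iiiB {X : Type*} [Nonempty X] (θ : ℝ → ℝ → ℝ)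
    (hθ : IsBAction θ) (d : X → X → ℝ) (hd : IsThetaMetric d θ) :
    ∀ (a : X) (a_seq b_seq : ℕ → X),
      Tendsto (fun n => d (a_seq n) a) atTop (𝓝 0) →
      Tendsto (fun n => d (a_seq n) (b_seq n)) atTop (𝓝 0) →
      Tendsto (fun n => d (b_seq n) a) atTop (𝓝 0) := by
  intro a a_seq b_seq ha hb
  refine tendsto_order.2 ⟨fun r hr => .of_forall fun n => hr.trans_le (hd.nonneg _ _),
    fun ε hε => ?_⟩
  obtain ⟨δ, hδ, hsmall⟩ := hθ.exists_forall_lt hε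
  filter_upwards [ha.eventually_lt_const hδ, hb.eventually_lt_const hδ] with n han hbn
  rw [hd.symm] at hbn
  exact (hd.tri _ (a_seq n) _).trans_lt
    (hsmall _ _ (hd.nonneg _ _) (hd.nonneg _ _) hbn han)
end

section
/- Let (X, d, θ) be a θ-metric space, where θ is a B-action. Then d satisfies the Niemytski–Wilson condition (iii-C): for every a ∈ X and every k > 0 there exists r > 0 such that for all b, c ∈ X, if d(a,b) ≥ k then d(a,c) + d(c,b) ≥ r. (In particular, if δ > 0 is chosen so that θ(x,y) < k whenever x, y ≥ 0 and x² + y² < δ², then r = δ/√2 works.) -/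
open Filter Topology

/-- A `B`-action is smaller than `k` at all pairs with sufficiently small sum. -/
theorem IsBAction.exists_pos_forall_add_lt {θ : ℝ → ℝ → ℝ} (hθ : IsBAction θ) {k : ℝ}
    (hk : 0 < k) :
    ∃ r > 0, ∀ x y : ℝ, 0 ≤ x → 0 ≤ y → x + y < r → θ x y < k := by
  have hk2 : 0 < k / 2 := half_pos hk
  have hlt : θ (k / 2) 0 < k := (hθ.le_self _ hk2).trans_lt (half_lt_self hk)
  have hev : ∀ᶠ t in 𝓝[Set.Ici 0] (0 : ℝ), θ (k / 2) t < k :=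
    (hθ.contOn_right _ hk2.le 0 Set.self_mem_Ici).eventually_lt_const hlt
  obtain ⟨ε, hε, hball⟩ := Metric.mem_nhdsWithin_iff.mp hev
  refine ⟨min (k / 2) ε, lt_min hk2 hε, fun x y hx hy hxy => ?_⟩
  obtain ⟨h1, h2⟩ := lt_min_iff.mp hxy
  have hyε : θ (k / 2) y < k := by
    refine hball ⟨?_, hy⟩
    rw [Metric.mem_ball, Real.dist_eq, sub_zero, abs_of_nonneg hy]
    linarith
  exact (hθ.strict_mono x y (k / 2) y hx hy hk2.le hy (.inr ⟨by linarith, le_rfl⟩)).trans hyε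

/-- Any `θ`-metric `d` satisfies the Niemytski–Wilson condition (iii-C);
moreover, if `δ > 0` is such that `θ x y < k` whenever `x, y ≥ 0` and `x² + y² < δ²`,
then `r = δ / √2` works. -/
theorem thetaMetric_niemytskiWilson_iiiC {X : Type*} [Nonempty X] (θ : ℝ → ℝ → ℝ)
    (hθ : IsBAction θ) (d : X → X → ℝ) (hd : IsThetaMetric d θ) :
    (∀ a : X, ∀ k : ℝ, 0 < k →
      ∃ r > 0, ∀ b c : X, k ≤ d a b → r ≤ d a c + d c b) ∧
    (∀ a : X, ∀ k : ℝ, 0 < k → ∀ δ : ℝ, 0 < δ →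
      (∀ x y : ℝ, 0 ≤ x → 0 ≤ y → x ^ 2 + y ^ 2 < δ ^ 2 → θ x y < k) →
      ∀ b c : X, k ≤ d a b → δ / Real.sqrt 2 ≤ d a c + d c b) := by
  refine ⟨fun a k hk => ?_, fun a k _ δ hδ hsmall b c hab => ?_⟩
  · obtain ⟨r, hr, hsmall⟩ := hθ.exists_pos_forall_add_lt hk
    refine ⟨r, hr, fun b c hab => ?_⟩
    by_contra! hlt
    exact (hab.trans (hd.tri a c b)).not_gt
      (hsmall _ _ (hd.nonneg a c) (hd.nonneg c b) hlt)
  · by_contra! hlt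
    have hx := hd.nonneg a c
    have hy := hd.nonneg c b
    refine (hab.trans (hd.tri a c b)).not_gt (hsmall _ _ hx hy ?_)
    have hδ2 : δ / √2 ≤ δ := div_le_self hδ.le (Real.one_le_sqrt.mpr one_le_two)
    nlinarith [mul_nonneg hx hy]
end

section
/- Let (X, d, θ) be a θ-metric space, where θ is a B-action. Then d satisfies the Niemytski–Wilson condition (iii-A): for every a ∈ X and every ε > 0 there exists φ > 0 such that for all b, c ∈ X, if d(a,b) < φ and d(b,c) < φ then d(a,c) < ε. -/
open Filter Topology

/-- Any `θ`-metric `d` satisfies the Niemytski–Wilson condition (iii-A). -/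
theorem thetaMetric_niemytskiWilson_iiiA {X : Type*} [Nonempty X] (θ : ℝ → ℝ → ℝ)
    (hθ : IsBAction θ) (d : X → X → ℝ) (hd : IsThetaMetric d θ) :
    ∀ a : X, ∀ ε : ℝ, 0 < ε →
      ∃ φ > 0, ∀ b c : X, d a b < φ → d b c < φ → d a c < ε := by
  intro a ε hε
  have hs : 0 < ε / 2 := half_pos hε
  have hlt : θ (ε / 2) 0 < ε := (hθ.le_self _ hs).trans_lt (half_lt_self hε)
  have hcont := hθ.contOn_right _ hs.le 0 Set.self_mem_Ici
  obtain ⟨δ, hδ, hball⟩ := Metric.mem_nhdsWithin_iff.mp (hcont (Iio_mem_nhds hlt))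
  have ht : θ (ε / 2) (δ / 2) < ε := by
    refine hball ⟨?_, (half_pos hδ).le⟩
    rw [Metric.mem_ball, Real.dist_eq, sub_zero, abs_of_pos (half_pos hδ)]
    exact half_lt_self hδ
  refine ⟨min (ε / 2) (δ / 2), lt_min hs (half_pos hδ), fun b c hab hbc => ?_⟩
  calc
    d a c ≤ θ (d a b) (d b c) := hd.tri a b c
    _ < θ (ε / 2) (δ / 2) :=
      hθ.strict_mono _ _ _ _ (hd.nonneg a b) (hd.nonneg b c) hs.le (half_pos hδ).le
        (Or.inl ⟨(hab.trans_le (min_le_left _ _)).le, hbc.trans_le (min_le_right _ _)⟩)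
    _ < ε := ht
end

section
/- Let (X, D) be an F-metric space with respect to a pair (f, α). Then D satisfies the Niemytski–Wilson condition (iii-A): for every a ∈ X and every ε > 0 there exists φ > 0 such that for all b, c ∈ X, if D(a,b) < φ and D(b,c) < φ then D(a,c) < ε. -/
open Filter Topology Finset

/-- A function of class `𝓕` tends to `-∞` at `0` from the right. -/
theorem IsFClassFun.exists_forall_lt {f : ℝ → ℝ} (hf : IsFClassFun f) (M : ℝ) :
    ∃ δ > 0, ∀ t, 0 < t → t < δ → f t < M := by
  by_contra! h
  choose t ht0 htlt hle using fun n : ℕ => h (1 / ((n : ℝ) + 1)) Nat.one_div_pos_of_nat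
  have hlim : Tendsto t atTop (𝓝 0) :=
    squeeze_zero (fun n => (ht0 n).le) (fun n => (htlt n).le) tendsto_one_div_add_atTop_nhds_zero_nat
  obtain ⟨n, hn⟩ := (((hf.2 t ht0).1 hlim).eventually_lt_atBot M).exists
  exact (hle n).not_gt hn

/-- Any `𝓕`-metric `D` satisfies the Niemytski–Wilson condition (iii-A). -/
theorem fMetric_niemytskiWilson_iiiA {X : Type*} [Nonempty X] (D : X → X → ℝ)
    (f : ℝ → ℝ) (α : ℝ) (hf : IsFClassFun f) (hα : 0 ≤ α) (hD : IsFMetric D f α) :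
    ∀ a : X, ∀ ε : ℝ, 0 < ε →
      ∃ φ > 0, ∀ b c : X, D a b < φ → D b c < φ → D a c < ε := by
  obtain ⟨h0, heq, -, hchain⟩ := hD
  intro a ε hε
  obtain ⟨δ, hδ, hlt⟩ := hf.exists_forall_lt (f ε - α)
  refine ⟨δ / 2, half_pos hδ, fun b c hab hbc => ?_⟩
  by_contra! hac
  have hmono : f ε ≤ f (D a c) := by
    rcases hac.eq_or_lt with h | h
    · rw [← h]
    · exact hf.1 _ _ hε h
  have hpos : 0 < D a b + D b c := by
    refine (add_nonneg (h0 a b) (h0 b c)).lt_of_ne' fun h => ?_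
    have hab0 : a = b := (heq a b).1 (by linarith [h0 a b, h0 b c])
    have hbc0 : b = c := (heq b c).1 (by linarith [h0 a b, h0 b c])
    have := (heq a c).2 (hab0.trans hbc0)
    linarith
  have key := hchain a c (hε.trans_le hac) 3 (by norm_num)
    (fun i => if i = 0 then a else if i = 1 then b else c) (by simp) (by simp)
  norm_num [Finset.sum_range_succ] at key
  linarith [hlt _ hpos (by linarith)]
end
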